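/- Suppose every approximate proximal point used by inexact FedExProx is an ε₁-absolute approximation, i.e., ‖x̃_{i,k+1} − prox_{γf_i}(x_k)‖² ≤ ε₁ for all i and k, where ε₁ ≥ 0. Then for any constant extrapolation parameter α with 0 < α ≤ 1/(4γL_γ), the iterates satisfy E_K ≤ (1 − αγμ / (8(1 + γL_max)))^K · E_0 + (4ε₁(1 + γL_max)/μ) · (2αL_γ + 1/γ) for every K ≥ 0. -/

import Mathlib

section InnerProduct

variable {F : Type*} [NormedAddCommGroup F] [InnerProductSpace ℝ F]

/-- A strongly convex function grows quadratically away from a minimiser. -/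
theorem StrongConvexOn.quadratic_growth {f : F → ℝ} {μ : ℝ} (hμ : 0 ≤ μ)
    (hf : StrongConvexOn Set.univ μ f) {x₀ : F} (hmin : ∀ x, f x₀ ≤ f x) (x : F) :
    μ / 2 * ‖x - x₀‖ ^ 2 ≤ f x - f x₀ := by
  set B := μ / 2 * ‖x - x₀‖ ^ 2 with hB
  have key : ∀ t : ℝ, 0 < t → t ≤ 1 → (1 - t) * B ≤ f x - f x₀ := by
    intro t ht ht1
    have h := (hmin _).trans (hf.2 (Set.mem_univ x) (Set.mem_univ x₀) ht.le (sub_nonneg.2 ht1)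
      (add_sub_cancel t 1))
    simp only [smul_eq_mul, ← hB] at h
    refine le_of_mul_le_mul_left ?_ ht
    linarith
  by_contra! hlt
  have hB0 : 0 ≤ B := by positivity
  have hA := sub_nonneg.2 (hmin x)
  have hBpos : 0 < B := hA.trans_lt hlt
  have h := key ((B - (f x - f x₀)) / (2 * B)) (div_pos (by linarith) (by linarith))
    ((div_le_one (by linarith)).2 (by linarith))
  have e : (1 - (B - (f x - f x₀)) / (2 * B)) * B = (B + (f x - f x₀)) / 2 := by
    field_simp
    ring
  rw [e] at h
  linarith

/-- Quadratic growth together with the first-order convexity inequality at the minimiser yields a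
Polyak–Łojasiewicz inequality. -/
theorem gap_le_norm_sq_of_growth {g v : F} {E m : ℝ} (hE : 0 ≤ E) (hm : 0 ≤ m)
    (hgrow : m / 2 * ‖v‖ ^ 2 ≤ E) (hlin : E ≤ inner ℝ g v) : m / 2 * E ≤ ‖g‖ ^ 2 := by
  rcases hE.eq_or_lt with rfl | hpos
  · simp
  refine le_of_mul_le_mul_right ?_ hpos
  have h1 : E ^ 2 ≤ ‖g‖ ^ 2 * ‖v‖ ^ 2 := by
    rw [← mul_pow]
    exact pow_le_pow_left₀ hE (hlin.trans (real_inner_le_norm _ _)) 2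
  calc m / 2 * E * E = m / 2 * E ^ 2 := by ring
    _ ≤ m / 2 * (‖g‖ ^ 2 * ‖v‖ ^ 2) := by gcongr
    _ = ‖g‖ ^ 2 * (m / 2 * ‖v‖ ^ 2) := by ring
    _ ≤ ‖g‖ ^ 2 * E := by gcongr

variable [CompleteSpace F]

theorem HasGradientAt.hasDerivAt_line {f : F → ℝ} {g x v : F} {t : ℝ}
    (h : HasGradientAt f g (x + t • v)) :
    HasDerivAt (fun s : ℝ => f (x + s • v)) (inner ℝ g v) t := by
  have hline : HasDerivAt (fun s : ℝ => x + s • v) v t := by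
    simpa using ((hasDerivAt_id t).smul_const v).const_add x
  simpa [Function.comp_def] using h.hasFDerivAt.comp_hasDerivAt t hline

/-- A function with `L`-Lipschitz gradient lies below its quadratic upper model. -/
theorem le_quadratic_of_lipschitz_gradient {f : F → ℝ} {f' : F → F} {L : ℝ}
    (hf : ∀ x, HasGradientAt f (f' x) x) (hL : ∀ x y, ‖f' x - f' y‖ ≤ L * ‖x - y‖) (x v : F) :
    f (x + v) ≤ f x + inner ℝ (f' x) v + L / 2 * ‖v‖ ^ 2 := by
  have hder (t : ℝ) : HasDerivAt
      (fun s : ℝ => f (x + s • v) - (s * inner ℝ (f' x) v + s ^ 2 * (L / 2 * ‖v‖ ^ 2)))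
      (inner ℝ (f' (x + t • v)) v - (inner ℝ (f' x) v + 2 * t * (L / 2 * ‖v‖ ^ 2))) t := by
    refine (hf _).hasDerivAt_line.sub (HasDerivAt.add ?_ ?_)
    · simpa using (hasDerivAt_id t).mul_const (inner ℝ (f' x) v)
    · simpa using (hasDerivAt_pow 2 t).mul_const (L / 2 * ‖v‖ ^ 2)
  have hanti := antitoneOn_of_hasDerivWithinAt_nonpos (convex_Icc (0 : ℝ) 1)
    (fun t _ => (hder t).continuousAt.continuousWithinAt)
    (fun t _ => (hder t).hasDerivWithinAt) (fun t ht => by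
      rw [interior_Icc] at ht
      have h1 : inner ℝ (f' (x + t • v) - f' x) v ≤ L * ‖t • v‖ * ‖v‖ := by
        refine (real_inner_le_norm _ _).trans ?_
        gcongr
        simpa using hL (x + t • v) x
      rw [inner_sub_left, norm_smul, Real.norm_of_nonneg ht.1.le] at h1
      linarith)
  have := hanti (Set.left_mem_Icc.2 zero_le_one) (Set.right_mem_Icc.2 zero_le_one) zero_le_one
  simp only [one_smul, zero_smul, add_zero] at this
  linarith

/-- The first-order characterisation of convexity. -/
theorem ConvexOn.add_inner_le_of_hasGradientAt {f : F → ℝ} {g x : F}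
    (hc : ConvexOn ℝ Set.univ f) (hf : HasGradientAt f g x) (v : F) :
    f x + inner ℝ g v ≤ f (x + v) := by
  have hline : ConvexOn ℝ Set.univ (fun s : ℝ => f (x + s • v)) := by
    refine ⟨convex_univ, fun s _ t _ a b ha hb hab => ?_⟩
    have := hc.2 (Set.mem_univ (x + s • v)) (Set.mem_univ (x + t • v)) ha hb hab
    convert this using 2
    have hx : x = a • x + b • x := by rw [← add_smul, hab, one_smul]
    nth_rewrite 1 [hx]
    simp only [smul_eq_mul, add_smul, mul_smul, smul_add]
    abel
  have hd : HasDerivAt (fun s : ℝ => f (x + s • v)) (inner ℝ g v) 0 :=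
    HasGradientAt.hasDerivAt_line (by simpa using hf)
  have := hline.le_slope_of_hasDerivAt (Set.mem_univ 0) (Set.mem_univ 1) zero_lt_one hd
  simp only [slope_def_field, one_smul, zero_smul, add_zero, sub_zero, div_one] at this
  linarith

/-- The norm of the gradient is controlled by the optimality gap. -/
theorem norm_gradient_sq_le_of_lipschitz_gradient {f : F → ℝ} {f' : F → F} {L m : ℝ}
    (hLpos : 0 < L) (hf : ∀ x, HasGradientAt f (f' x) x)
    (hL : ∀ x y, ‖f' x - f' y‖ ≤ L * ‖x - y‖) (hm : ∀ x, m ≤ f x) (x : F) :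
    ‖f' x‖ ^ 2 ≤ 2 * L * (f x - m) := by
  have h := (hm _).trans (le_quadratic_of_lipschitz_gradient hf hL x (-(1 / L) • f' x))
  rw [inner_smul_right, real_inner_self_eq_norm_sq, norm_smul, mul_pow, Real.norm_eq_abs,
    sq_abs] at h
  have e : L / 2 * ((-(1 / L)) ^ 2 * ‖f' x‖ ^ 2) = 1 / (2 * L) * ‖f' x‖ ^ 2 := by
    field_simp
  have e' : -(1 / L) * ‖f' x‖ ^ 2 = - 2 * (1 / (2 * L) * ‖f' x‖ ^ 2) := by
    field_simp
  rw [e, e'] at h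
  have h2 : 1 / (2 * L) * ‖f' x‖ ^ 2 ≤ f x - m := by linarith
  calc ‖f' x‖ ^ 2 = 2 * L * (1 / (2 * L) * ‖f' x‖ ^ 2) := by field_simp
    _ ≤ _ := by gcongr

/-- Optimality condition for the proximal point. -/
theorem gradient_eq_of_isMinOn_prox {f : F → ℝ} {g x p : F} {γ : ℝ}
    (hf : HasGradientAt f g p)
    (hp : IsMinOn (fun z => f z + ‖z - x‖ ^ 2 / (2 * γ)) Set.univ p) :
    g = (1 / γ) • (x - p) := by
  refine ext_inner_right ℝ fun v => ?_
  have hd : HasDerivAt (fun s : ℝ => f (p + s • v) +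
      (‖p - x‖ ^ 2 + s * (2 * inner ℝ (p - x) v) + s ^ 2 * ‖v‖ ^ 2) / (2 * γ))
      (inner ℝ g v + (2 * inner ℝ (p - x) v) / (2 * γ)) 0 := by
    refine (HasGradientAt.hasDerivAt_line (by simpa using hf)).add (HasDerivAt.div_const ?_ _)
    have hlin := ((hasDerivAt_id (0 : ℝ)).mul_const (2 * inner ℝ (p - x) v)).const_add
      (‖p - x‖ ^ 2)
    simpa using hlin.fun_add ((hasDerivAt_pow 2 (0 : ℝ)).mul_const (‖v‖ ^ 2))
  have hmin : IsLocalMin (fun s : ℝ => f (p + s • v) +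
      (‖p - x‖ ^ 2 + s * (2 * inner ℝ (p - x) v) + s ^ 2 * ‖v‖ ^ 2) / (2 * γ)) 0 := by
    refine Filter.Eventually.of_forall fun s => ?_
    have h := hp (Set.mem_univ (p + s • v))
    have e : ‖p + s • v - x‖ ^ 2 =
        ‖p - x‖ ^ 2 + s * (2 * inner ℝ (p - x) v) + s ^ 2 * ‖v‖ ^ 2 := by
      rw [add_sub_right_comm, norm_add_sq_real, inner_smul_right, norm_smul, mul_pow,
        Real.norm_eq_abs, sq_abs]
      ring
    simp only [Set.mem_ofPred_eq, e] at h
    simpa using h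
  have h0 := hmin.hasDerivAt_eq_zero hd
  rw [mul_div_mul_left _ _ two_ne_zero] at h0
  rw [real_inner_smul_left, ← neg_sub p x, inner_neg_left]
  linear_combination h0

/-- The Moreau envelope of a convex function lies above its linearisations. -/
theorem ConvexOn.moreau_add_inner_le {f : F → ℝ} {g x p : F} {γ : ℝ} (hγ : 0 < γ)
    (hc : ConvexOn ℝ Set.univ f) (hf : HasGradientAt f g p)
    (hp : IsMinOn (fun z => f z + ‖z - x‖ ^ 2 / (2 * γ)) Set.univ p) (y q : F) :
    f p + ‖p - x‖ ^ 2 / (2 * γ) + inner ℝ ((1 / γ) • (x - p)) (y - x) ≤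
      f q + ‖q - y‖ ^ 2 / (2 * γ) := by
  have h1 := hc.add_inner_le_of_hasGradientAt hf (q - p)
  rw [gradient_eq_of_isMinOn_prox hf hp, add_sub_cancel] at h1
  have h2 : ‖q - y‖ ^ 2 = ‖p - x‖ ^ 2 + 2 * inner ℝ (p - x) ((q - p) - (y - x)) +
      ‖(q - p) - (y - x)‖ ^ 2 := by
    rw [← norm_add_sq_real]
    congr 2
    abel
  rw [h2, ← neg_sub x p, inner_neg_left, inner_sub_right (x - p) (q - p), real_inner_smul_left]
  rw [real_inner_smul_left] at h1
  have h3 : 0 ≤ ‖(q - p) - (y - x)‖ ^ 2 / (2 * γ) := by positivity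
  have e : (‖-(x - p)‖ ^ 2 + 2 * -(inner ℝ (x - p) (q - p) - inner ℝ (x - p) (y - x)) +
      ‖q - p - (y - x)‖ ^ 2) / (2 * γ) = ‖-(x - p)‖ ^ 2 / (2 * γ)
      - 1 / γ * inner ℝ (x - p) (q - p) + 1 / γ * inner ℝ (x - p) (y - x) +
      ‖(q - p) - (y - x)‖ ^ 2 / (2 * γ) := by
    field_simp
    ring
  rw [e]
  linarith

/-- The optimality gap of a smooth function is controlled by that of its Moreau envelope. -/
theorem gap_le_moreau_gap {f : F → ℝ} {f' : F → F} {L m γ : ℝ} (hγ : 0 < γ) (hLpos : 0 < L)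
    (hf : ∀ x, HasGradientAt f (f' x) x) (hL : ∀ x y, ‖f' x - f' y‖ ≤ L * ‖x - y‖)
    (hm : ∀ x, m ≤ f x) {x p : F}
    (hp : IsMinOn (fun z => f z + ‖z - x‖ ^ 2 / (2 * γ)) Set.univ p) :
    f x - m ≤ (1 + γ * L) * (f p + ‖p - x‖ ^ 2 / (2 * γ) - m) := by
  have hg := gradient_eq_of_isMinOn_prox (hf p) hp
  have h1 := le_quadratic_of_lipschitz_gradient hf hL p (x - p)
  have h2 := norm_gradient_sq_le_of_lipschitz_gradient hLpos hf hL hm p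
  rw [hg, norm_smul, mul_pow, Real.norm_eq_abs, sq_abs] at h2
  rw [hg, add_sub_cancel, real_inner_smul_left, real_inner_self_eq_norm_sq] at h1
  rw [norm_sub_rev p x]
  have h3 := mul_le_mul_of_nonneg_left h2 (by positivity : 0 ≤ γ / 2)
  have e1 : γ / 2 * ((1 / γ) ^ 2 * ‖x - p‖ ^ 2) = ‖x - p‖ ^ 2 / (2 * γ) := by field_simp
  have e2 : 1 / γ * ‖x - p‖ ^ 2 = 2 * (‖x - p‖ ^ 2 / (2 * γ)) := by field_simp
  have e3 : L / 2 * ‖x - p‖ ^ 2 = γ * L * (‖x - p‖ ^ 2 / (2 * γ)) := by field_simp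
  rw [e1] at h3
  rw [e2, e3] at h1
  linarith

/-- One step of gradient descent with an additive error in the direction. -/
theorem inexact_gradient_step {M : F → ℝ} {M' : F → F} {Lγ α γ ε : ℝ} (hγ : 0 < γ) (hL0 : 0 < Lγ)
    (hα : 0 < α) (hαle : α ≤ 1 / (4 * γ * Lγ)) (hM : ∀ x, HasGradientAt M (M' x) x)
    (hL : ∀ x y, ‖M' x - M' y‖ ≤ Lγ * ‖x - y‖) (x e : F) (he : ‖e‖ ^ 2 ≤ ε) :
    M (x + α • (e - γ • M' x)) ≤
      M x - α * γ / 4 * ‖M' x‖ ^ 2 + α / 2 * (2 * α * Lγ + 1 / γ) * ε := by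
  have h1 := le_quadratic_of_lipschitz_gradient hM hL x (α • (e - γ • M' x))
  set g := M' x
  have hsmall : α * γ * Lγ ≤ 1 / 4 := by
    rw [le_div_iff₀ (by positivity)] at hαle
    linarith
  have h2 : ‖e - γ • g‖ ^ 2 ≤ 2 * ‖e‖ ^ 2 + 2 * γ ^ 2 * ‖g‖ ^ 2 := by
    have h := parallelogram_law_with_norm ℝ e (γ • g)
    rw [norm_smul, Real.norm_of_nonneg hγ.le] at h
    nlinarith [mul_self_nonneg ‖e + γ • g‖]
  have h3 : inner ℝ g e ≤ γ / 2 * ‖g‖ ^ 2 + 1 / (2 * γ) * ‖e‖ ^ 2 := by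
    refine (real_inner_le_norm _ _).trans ?_
    have e' : γ / 2 * ‖g‖ ^ 2 + 1 / (2 * γ) * ‖e‖ ^ 2 - ‖g‖ * ‖e‖ =
        1 / (2 * γ) * (γ * ‖g‖ - ‖e‖) ^ 2 := by
      field_simp
      ring
    have : 0 ≤ 1 / (2 * γ) * (γ * ‖g‖ - ‖e‖) ^ 2 := by positivity
    linarith
  rw [inner_smul_right, inner_sub_right, inner_smul_right, real_inner_self_eq_norm_sq, norm_smul,
    Real.norm_of_nonneg hα.le, mul_pow] at h1
  have h4 := mul_le_mul_of_nonneg_left h3 hα.le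
  have h5 := mul_le_mul_of_nonneg_left h2 (by positivity : 0 ≤ Lγ / 2 * α ^ 2)
  have h6 := mul_le_mul_of_nonneg_right hsmall (by positivity : 0 ≤ α * γ * ‖g‖ ^ 2)
  have h7 := mul_le_mul_of_nonneg_left he
    (by positivity : 0 ≤ α / 2 * (2 * α * Lγ + 1 / γ))
  have e1 : α / 2 * (2 * α * Lγ + 1 / γ) * ‖e‖ ^ 2 =
      α ^ 2 * Lγ * ‖e‖ ^ 2 + α * (1 / (2 * γ) * ‖e‖ ^ 2) := by
    field_simp
  rw [e1] at h7
  linarith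

end InnerProduct

theorem norm_average_sq_le {F : Type*} [NormedAddCommGroup F] [NormedSpace ℝ F] {n : ℕ}
    (hn : 1 ≤ n) (v : Fin n → F) {ε : ℝ} (hv : ∀ i, ‖v i‖ ^ 2 ≤ ε) :
    ‖(1 / (n : ℝ)) • ∑ i, v i‖ ^ 2 ≤ ε := by
  have hn' : (0 : ℝ) < n := by exact_mod_cast hn
  have hε : 0 ≤ ε := (sq_nonneg _).trans (hv ⟨0, hn⟩)
  have h : ‖(1 / (n : ℝ)) • ∑ i, v i‖ ≤ √ε := by
    rw [norm_smul, Real.norm_of_nonneg (by positivity)]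
    calc 1 / (n : ℝ) * ‖∑ i, v i‖ ≤ 1 / (n : ℝ) * ∑ _i : Fin n, √ε := by
          gcongr
          exact norm_sum_le_of_le _ fun i _ => Real.le_sqrt_of_sq_le (hv i)
      _ = √ε := by
          rw [Finset.sum_const, Finset.card_univ, Fintype.card_fin, nsmul_eq_mul]
          field_simp
  calc _ ≤ √ε ^ 2 := by gcongr
    _ = ε := Real.sq_sqrt hε

theorem le_pow_mul_add_of_contraction {E : ℕ → ℝ} {ρ δ : ℝ} (hρ1 : ρ ≤ 1) (hδ : 0 ≤ δ) (h : ∀ k, E (k + 1) ≤ (1 - ρ) * E k + ρ * δ) (k : ℕ) :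
    E k ≤ (1 - ρ) ^ k * E 0 + δ := by
  induction k with
  | zero => simpa using hδ
  | succ k ih =>
    have := mul_le_mul_of_nonneg_left ih (sub_nonneg.2 hρ1)
    rw [pow_succ']
    linarith [h k]


theorem fedexprox_abs_E
    {d n : ℕ} (hn : 1 ≤ n)
    (f : Fin n → EuclideanSpace ℝ (Fin d) → ℝ)
    (f' : Fin n → EuclideanSpace ℝ (Fin d) → EuclideanSpace ℝ (Fin d))
    (L : Fin n → ℝ) (hLpos : ∀ i, 0 < L i)
    (hdiff : ∀ i x, HasGradientAt (f i) (f' i x) x)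
    (hconv : ∀ i, ConvexOn ℝ Set.univ (f i))
    (hsmooth : ∀ i x y, ‖f' i x - f' i y‖ ≤ L i * ‖x - y‖)
    (Lmax : ℝ) (hLmax : IsGreatest (Set.range L) Lmax)
    (xstar : EuclideanSpace ℝ (Fin d)) (hinterp : ∀ i, f' i xstar = 0)
    (μ : ℝ) (hμ : 0 < μ)
    (hsc : StrongConvexOn Set.univ μ (fun x => (1 / (n : ℝ)) * ∑ i, f i x))
    (γ : ℝ) (hγ : 0 < γ)
    (prox : Fin n → EuclideanSpace ℝ (Fin d) → EuclideanSpace ℝ (Fin d))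
    (hprox : ∀ i x, IsMinOn (fun z => f i z + ‖z - x‖ ^ 2 / (2 * γ)) Set.univ (prox i x))
    (hproxu : ∀ i x q, IsMinOn (fun z => f i z + ‖z - x‖ ^ 2 / (2 * γ)) Set.univ q → q = prox i x)
    (M : EuclideanSpace ℝ (Fin d) → ℝ)
    (hM : ∀ x, M x = (1 / (n : ℝ)) * ∑ i, (f i (prox i x) + ‖prox i x - x‖ ^ 2 / (2 * γ)))
    (M' : EuclideanSpace ℝ (Fin d) → EuclideanSpace ℝ (Fin d))
    (hM' : ∀ x, M' x = (1 / ((n : ℝ) * γ)) • ∑ i, (x - prox i x))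
    (hMdiff : ∀ x, HasGradientAt M (M' x) x)
    (Minf : ℝ) (hMinf : Minf = M xstar) (hMinfLB : ∀ x, Minf ≤ M x)
    (Lγ : ℝ) (hLγ : 0 < Lγ)
    (hMLip : ∀ x y, ‖M' x - M' y‖ ≤ Lγ * ‖x - y‖)
    (α : ℝ)
    (xseq : ℕ → EuclideanSpace ℝ (Fin d))
    (xtil : Fin n → ℕ → EuclideanSpace ℝ (Fin d))
    (hrec : ∀ k : ℕ, xseq (k + 1) = xseq k + α • ((1 / (n : ℝ)) • (∑ i, xtil i k) - xseq k))
    (ε₁ : ℝ) (hε₁ : 0 ≤ ε₁)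
    (happrox : ∀ (i : Fin n) (k : ℕ), ‖xtil i k - prox i (xseq k)‖ ^ 2 ≤ ε₁)
    (hα : 0 < α) (hαle : α ≤ 1 / (4 * γ * Lγ))
    : ∀ K : ℕ,
      γ * M (xseq K) - γ * Minf ≤
        (1 - α * γ * μ / (8 * (1 + γ * Lmax))) ^ K * (γ * M (xseq 0) - γ * Minf)
          + 4 * ε₁ * (1 + γ * Lmax) / μ * (2 * α * Lγ + 1 / γ) := by
  have hn' : (0 : ℝ) < n := by exact_mod_cast hn
  have hLle (i) : L i ≤ Lmax := hLmax.2 ⟨i, rfl⟩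
  have hLmaxpos : 0 < Lmax := (hLpos ⟨0, hn⟩).trans_le (hLle _)
  set c := 1 + γ * Lmax with hc
  have hcpos : 0 < c := by positivity
  have hfmin (i x) : f i xstar ≤ f i x := by
    have h := (hconv i).add_inner_le_of_hasGradientAt (hdiff i xstar) (x - xstar)
    simpa [hinterp i] using h
  have hgrow (x) : μ / c / 2 * ‖x - xstar‖ ^ 2 ≤ M x - Minf := by
    have h1 := hsc.quadratic_growth hμ.le (x₀ := xstar)
      (fun y => mul_le_mul_of_nonneg_left (Finset.sum_le_sum fun i _ => hfmin i y)
        (by positivity)) x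
    have h2 : Minf ≤ (1 / (n : ℝ)) * ∑ i, f i xstar := by
      rw [hMinf, hM]
      gcongr with i
      simpa using hprox i xstar (Set.mem_univ xstar)
    have h3 : (1 / (n : ℝ)) * ∑ i, f i x - (1 / (n : ℝ)) * ∑ i, f i xstar ≤
        c * (M x - (1 / (n : ℝ)) * ∑ i, f i xstar) := by
      rw [hM, ← mul_sub, ← mul_sub, ← Finset.sum_sub_distrib, ← Finset.sum_sub_distrib,
        mul_left_comm, Finset.mul_sum _ _ c]
      gcongr with i
      refine (gap_le_moreau_gap hγ (hLpos i) (hdiff i) (hsmooth i) (hfmin i) (hprox i x)).trans ?_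
      have : 0 ≤ f i (prox i x) + ‖prox i x - x‖ ^ 2 / (2 * γ) - f i xstar := by
        have := hfmin i (prox i x)
        have : 0 ≤ ‖prox i x - x‖ ^ 2 / (2 * γ) := by positivity
        linarith
      rw [hc]
      gcongr
      exact hLle i
    have h4 : μ / 2 * ‖x - xstar‖ ^ 2 ≤ c * (M x - Minf) :=
      (h1.trans h3).trans (by gcongr)
    calc μ / c / 2 * ‖x - xstar‖ ^ 2 = (μ / 2 * ‖x - xstar‖ ^ 2) / c := by ring
      _ ≤ M x - Minf := (div_le_iff₀' hcpos).2 h4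
  have hlin (x) : M x - Minf ≤ inner ℝ (M' x) (x - xstar) := by
    have h : M x + inner ℝ (M' x) (xstar - x) ≤ Minf := by
      have e : M' x = (1 / (n : ℝ)) • ∑ i, (1 / γ) • (x - prox i x) := by
        rw [hM', ← Finset.smul_sum, smul_smul, one_div_mul_one_div]
      rw [hMinf, hM x, hM xstar, e, real_inner_smul_left, sum_inner, ← mul_add,
        ← Finset.sum_add_distrib]
      refine mul_le_mul_of_nonneg_left (Finset.sum_le_sum fun i _ => ?_) (by positivity)
      exact (hconv i).moreau_add_inner_le hγ (hdiff i _) (hprox i x) _ _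
    rw [← neg_sub x xstar, inner_neg_right] at h
    linarith
  have hgap (x) : 0 ≤ M x - Minf := sub_nonneg.2 (hMinfLB x)
  have hPL (x) : μ / c / 2 * (M x - Minf) ≤ ‖M' x‖ ^ 2 :=
    gap_le_norm_sq_of_growth (hgap x) (by positivity) (hgrow x) (hlin x)
  have hupper (x) : ‖M' x‖ ^ 2 ≤ 2 * Lγ * (M x - Minf) :=
    norm_gradient_sq_le_of_lipschitz_gradient hLγ hMdiff hMLip hMinfLB x
  set ρ := α * γ * μ / (8 * c) with hρ
  have hρ0 : 0 < ρ := by positivity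
  set δ := 4 * ε₁ * c / μ * (2 * α * Lγ + 1 / γ) with hδ
  have hδ0 : 0 ≤ δ := by positivity
  have hρδ : γ * (α / 2 * (2 * α * Lγ + 1 / γ) * ε₁) = ρ * δ := by
    rw [hρ, hδ]
    field_simp
    ring
  have hstep (k) : γ * M (xseq (k + 1)) - γ * Minf ≤
      (1 - ρ) * (γ * M (xseq k) - γ * Minf) + ρ * δ := by
    set e := (1 / (n : ℝ)) • ∑ i, (xtil i k - prox i (xseq k)) with he
    have hnext : xseq (k + 1) = xseq k + α • (e - γ • M' (xseq k)) := by
      rw [hrec, he, hM', smul_smul]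
      have : γ * (1 / ((n : ℝ) * γ)) = 1 / n := by field_simp
      rw [this, Finset.sum_sub_distrib, Finset.sum_sub_distrib, Finset.sum_const,
        Finset.card_univ, Fintype.card_fin, smul_sub (1 / (n : ℝ)), smul_sub (1 / (n : ℝ)),
        ← Nat.cast_smul_eq_nsmul ℝ, smul_smul, one_div_mul_cancel hn'.ne', one_smul]
      congr 2
      abel
    have h1 := inexact_gradient_step hγ hLγ hα hαle hMdiff hMLip (xseq k) e
      (norm_average_sq_le hn _ fun i => happrox i k)
    rw [← hnext] at h1
    have h2 := mul_le_mul_of_nonneg_left (hPL (xseq k)) (by positivity : 0 ≤ α * γ / 4)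
    have h3 : α * γ / 4 * (μ / c / 2 * (M (xseq k) - Minf)) = ρ * (M (xseq k) - Minf) := by
      rw [hρ]
      field_simp
      ring
    have h4 := mul_le_mul_of_nonneg_left h1 hγ.le
    have h5 := mul_le_mul_of_nonneg_left (h3 ▸ h2) hγ.le
    linarith [hρδ]
  intro K
  by_cases hρ1 : ρ ≤ 1
  · exact le_pow_mul_add_of_contraction (E := fun k => γ * M (xseq k) - γ * Minf)
      hρ1 hδ0 hstep K
  · have hzero (x) : M x - Minf = 0 := by
      refine le_antisymm ?_ (hgap x)
      by_contra! hpos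
      have h1 := (hPL x).trans (hupper x)
      have h2 : μ / c / 2 ≤ 2 * Lγ := le_of_mul_le_mul_right h1 hpos
      have h3 : α * γ * Lγ ≤ 1 / 4 := by
        rw [le_div_iff₀ (by positivity)] at hαle
        linarith
      have h4 := mul_le_mul_of_nonneg_left h2 (by positivity : 0 ≤ α * γ / 4)
      have h5 : α * γ / 4 * (μ / c / 2) = ρ := by
        rw [hρ]
        field_simp
        ring
      linarith
    rw [← mul_sub, ← mul_sub, hzero, hzero]
    simpa using hδ0
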